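/- Define φ : 𝒮 → 𝒟 by φ(S) := Φ(δ_S), i.e. (φ(S))_N = δ_{S_N}. Then φ(S) ∈ ext(𝒟) for every S ∈ 𝒮, and for every ν ∈ 𝒟 the pushforward m := (Φ⁻¹(ν)) ∘ φ⁻¹ is a Borel probability measure on 𝒟 with m(ext(𝒟)) = 1 which represents ν, i.e. λ(ν) = ∫_𝒟 λ dm for every continuous affine λ : 𝒟 → ℝ. -/

import Mathlib

open MeasureTheory Filter
open scoped ENNReal NNReal

namespace VMCPaper

abbrev Path : Type := ℕ → ℕ

def staircaseSet : Set Path :=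
  {S | (∀ N, S N ≤ N) ∧ ∀ N, S (N + 1) = S N ∨ S (N + 1) = N + 1}

noncomputable def pr {α : Type*} [MeasurableSpace α] (μ : Measure α) (A : Set α) : ℝ :=
  (μ A).toReal

def IsSMC (μ : Measure Path) : Prop :=
  IsProbabilityMeasure μ ∧ μ staircaseSet = 1 ∧
  ∀ (N : ℕ) (a : ℕ → ℕ),
    0 < pr μ {S | ∀ i ≤ N, S i = a i} →
    pr μ {S | (∀ i ≤ N, S i = a i) ∧ S (N + 1) = a (N + 1)} /
        pr μ {S | ∀ i ≤ N, S i = a i}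
      = pr μ {S | S N = a N ∧ S (N + 1) = a (N + 1)} / pr μ {S | S N = a N}

noncomputable def marginals (μ : Measure Path) : ℕ → ℕ → ℝ :=
  fun N a => pr μ {S | S N = a}

def D : Set (ℕ → ℕ → ℝ) :=
  {ν | (∀ N a, 0 ≤ ν N a) ∧ (∀ N a, N < a → ν N a = 0) ∧
       (∀ N, ∑ a ∈ Finset.range (N + 1), ν N a = 1) ∧
       ∀ N a, a ≤ N → ν (N + 1) a ≤ ν N a}

def PMC : Set (ProbabilityMeasure Path) := {μ | IsSMC (μ : Measure Path)}

def IsBalayage (π : ℕ → ℕ → ℝ) : Prop :=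
  (∀ N a, 0 ≤ π N a) ∧ (∀ N a, N < a → π N a = 0) ∧
  ∀ N, ∑ a ∈ Finset.range (N + 1), π N a = 1

def Dpi (π : ℕ → ℕ → ℝ) : Set (ℕ → ℕ → ℝ) :=
  {ν | ν ∈ D ∧ ∀ N a, a ≤ N → ν N a = ν (N + 1) a + ν (N + 1) (N + 1) * π N a}

def PMCpi (π : ℕ → ℕ → ℝ) : Set (Measure Path) :=
  {μ | IsSMC μ ∧ ∀ N a, a ≤ N →
    0 < pr μ {S | S (N + 1) = N + 1} →
    pr μ {S | S N = a ∧ S (N + 1) = N + 1} / pr μ {S | S (N + 1) = N + 1} = π N a}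

def pathTail : MeasurableSpace Path :=
  ⨅ N : ℕ, MeasurableSpace.comap (fun (S : Path) (i : ℕ) => S (N + i)) inferInstance

def HasTrivialTail (μ : Measure Path) : Prop :=
  ∀ A : Set Path, MeasurableSet[pathTail] A → μ A = 0 ∨ μ A = 1

def AffineOn {E : Type*} [AddCommMonoid E] [Module ℝ E] (f : E → ℝ) (K : Set E) : Prop :=
  ∀ x ∈ K, ∀ y ∈ K, ∀ t : ℝ, 0 ≤ t → t ≤ 1 →
    f (t • x + (1 - t) • y) = t * f x + (1 - t) * f y

def RepresentsOn {E : Type*} [AddCommMonoid E] [Module ℝ E] [TopologicalSpace E]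
    [MeasurableSpace E] (m : Measure E) (K : Set E) (x : E) : Prop :=
  ∀ f : E → ℝ, ContinuousOn f K → AffineOn f K → f x = ∫ y, f y ∂m

def IsChoquetSimplex {E : Type*} [AddCommMonoid E] [Module ℝ E] [TopologicalSpace E]
    [MeasurableSpace E] (K : Set E) : Prop :=
  ∀ x ∈ K, ∃! m : Measure E,
    IsProbabilityMeasure m ∧ m (Set.extremePoints ℝ K) = 1 ∧ RepresentsOn m K x

noncomputable def hitTime (x : Path) (A : Set ℕ) : ℕ → ℕ∞
  | 0 => ⨅ i ∈ {i : ℕ | x i ∈ A}, (i : ℕ∞)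
  | k + 1 => ⨅ i ∈ {i : ℕ | hitTime x A k < (i : ℕ∞) ∧ x i ∈ A}, (i : ℕ∞)

noncomputable def proj (N : ℕ) (x : Path) : Path := fun i =>
  if hitTime x {a | a ≤ N} i = ⊤ then 0 else x (hitTime x {a | a ≤ N} i).toNat

def pathSpace (N : ℕ) : Set Path :=
  {x | (∀ i, x i ≤ N) ∧ ∀ i, x i = 0 → ∀ j, i ≤ j → x j = 0}

def fullPathSpace : Set Path := {x | ∀ i, x i = 0 → ∀ j, i ≤ j → x j = 0}

def IsMarkovChain {Ω : Type*} [MeasurableSpace Ω] (P : Measure Ω) (Y : ℕ → Ω → ℕ) : Prop :=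
  (∀ i, Measurable (Y i)) ∧
  (∀ (n : ℕ) (b : ℕ → ℕ),
    0 < (P {ω | ∀ i ≤ n, Y i ω = b i}).toReal →
    (P {ω | (∀ i ≤ n, Y i ω = b i) ∧ Y (n + 1) ω = b (n + 1)}).toReal /
        (P {ω | ∀ i ≤ n, Y i ω = b i}).toReal
      = (P {ω | Y n ω = b n ∧ Y (n + 1) ω = b (n + 1)}).toReal /
        (P {ω | Y n ω = b n}).toReal) ∧
  (∀ m n b c : ℕ,
    0 < (P {ω | Y m ω = b}).toReal → 0 < (P {ω | Y n ω = b}).toReal →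
    (P {ω | Y m ω = b ∧ Y (m + 1) ω = c}).toReal / (P {ω | Y m ω = b}).toReal
      = (P {ω | Y n ω = b ∧ Y (n + 1) ω = c}).toReal / (P {ω | Y n ω = b}).toReal)

def IsVMC {Ω : Type*} [MeasurableSpace Ω] (P : Measure Ω) (X : Ω → ℕ → Path) : Prop :=
  IsProbabilityMeasure P ∧
  Measurable X ∧
  (∀ ω N, X ω N ∈ pathSpace N) ∧
  (∀ ω N, proj N (X ω (N + 1)) = X ω N) ∧
  ∀ N, IsMarkovChain P (fun i ω => X ω N i)

def S0 {Ω : Type*} (X : Ω → ℕ → Path) (N : ℕ) (ω : Ω) : ℕ := X ω N 0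

noncomputable def Vis {Ω : Type*} (X : Ω → ℕ → Path) (a : ℕ) (ω : Ω) : ℕ∞ :=
  {k : ℕ | hitTime (X ω a) {a} k ≠ ⊤}.encard

open scoped Classical in
noncomputable def Sak {Ω : Type*} (X : Ω → ℕ → Path) (a k N : ℕ) (ω : Ω) : ℕ :=
  if (k : ℕ∞) < Vis X a ω ∧ hitTime (X ω N) {a} k ≠ ⊤ then
    X ω N ((hitTime (X ω N) {a} k).toNat + 1)
  else 0

def InfinitelyVisited {Ω : Type*} [MeasurableSpace Ω] (P : Measure Ω)
    (X : Ω → ℕ → Path) (a : ℕ) : Prop := P {ω | Vis X a ω = ⊤} = 1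

def OnceVisited {Ω : Type*} [MeasurableSpace Ω] (P : Measure Ω)
    (X : Ω → ℕ → Path) (a : ℕ) : Prop := P {ω | Vis X a ω = 1} = 1

def NeverVisited {Ω : Type*} [MeasurableSpace Ω] (P : Measure Ω)
    (X : Ω → ℕ → Path) (a : ℕ) : Prop := P {ω | Vis X a ω = 0} = 1

def RandomlyVisited {Ω : Type*} [MeasurableSpace Ω] (P : Measure Ω)
    (X : Ω → ℕ → Path) (a : ℕ) : Prop :=
  ¬ InfinitelyVisited P X a ∧ ¬ OnceVisited P X a ∧ ¬ NeverVisited P X a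

def sigmaX {Ω : Type*} (X : Ω → ℕ → Path) : MeasurableSpace Ω :=
  MeasurableSpace.comap X inferInstance

def tailVMC {Ω : Type*} (X : Ω → ℕ → Path) : MeasurableSpace Ω :=
  ⨅ N : ℕ, MeasurableSpace.comap (fun ω (M : ℕ) => X ω (N + M)) inferInstance

def TailTrivial {Ω : Type*} [MeasurableSpace Ω] (P : Measure Ω) (X : Ω → ℕ → Path) : Prop :=
  ∀ A : Set Ω, MeasurableSet[tailVMC X] A → P A = 0 ∨ P A = 1

def RepresentedBy {Ω : Type*} [MeasurableSpace Ω] (P : Measure Ω) (X : Ω → ℕ → Path)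
    (ν : ℕ → ℕ → ℝ) (K : ℕ → ℕ → ℕ → ℝ) : Prop :=
  (∀ N a, a ≤ N → (P {ω | X ω N 0 = a}).toReal = ν N a) ∧
  ∀ N a b, a ≤ N → b ≤ N → 0 < (P {ω | X ω N 0 = a}).toReal →
    (P {ω | X ω N 0 = a ∧ X ω N 1 = b}).toReal / (P {ω | X ω N 0 = a}).toReal = K N a b

noncomputable def piK (K : ℕ → ℕ → ℕ → ℝ) (N : ℕ) (b : ℕ) : ℝ :=
  if K (N + 1) (N + 1) (N + 1) < 1 then
    K (N + 1) (N + 1) b / (1 - K (N + 1) (N + 1) (N + 1))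
  else if b = 0 then 1 else 0

def IsVTM (K : ℕ → ℕ → ℕ → ℝ) : Prop :=
  (∀ N a b, 0 ≤ K N a b) ∧
  (∀ N a b, a ≤ N → N < b → K N a b = 0) ∧
  (∀ N a, a ≤ N → ∑ b ∈ Finset.range (N + 1), K N a b = 1) ∧
  (∀ N, K N 0 0 = 1) ∧
  (∀ N a b, a ≤ N → b ≤ N → K N a b = K (N + 1) a b + K (N + 1) a (N + 1) * piK K N b)

def mpow (N : ℕ) (M : ℕ → ℕ → ℝ) : ℕ → ℕ → ℕ → ℝ
  | 0 => fun a b => if a = b then 1 else 0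
  | n + 1 => fun a b => ∑ c ∈ Finset.range (N + 1), mpow N M n a c * M c b

def IsIrreducibleVTM (K : ℕ → ℕ → ℕ → ℝ) : Prop :=
  ∀ N, 1 ≤ N → ∀ a b, 1 ≤ a → a ≤ N → 1 ≤ b → b ≤ N →
    ∃ n, 0 < mpow N (K N) n a b

def IsClassical {Ω : Type*} [MeasurableSpace Ω] (P : Measure Ω) (X : Ω → ℕ → Path) : Prop :=
  ∀ᵐ ω ∂P, ∃ x : Path, x ∈ fullPathSpace ∧
    (∀ i, ∀ᶠ N in atTop, X ω N i = x i) ∧ ∀ N, X ω N = proj N x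


noncomputable def phi (S : Path) : ℕ → ℕ → ℝ := fun N a => if S N = a then 1 else 0

theorem phi_mem_D {S : Path} (hS : S ∈ staircaseSet) : phi S ∈ D := by
  obtain ⟨h1, h2⟩ := hS
  refine ⟨?_, ?_, ?_, ?_⟩
  · intro N a
    unfold phi
    split_ifs <;> norm_num
  · intro N a h
    unfold phi
    rw [if_neg]
    have := h1 N
    omega
  · intro N
    have := h1 N
    simp only [phi, Finset.sum_ite_eq, Finset.mem_range]
    rw [if_pos (by omega)]
  · intro N a h
    unfold phi
    have := h2 N
    split_ifs <;> first | (exfalso; omega) | norm_num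

theorem phi_extreme {S : Path} (hS : S ∈ staircaseSet) : phi S ∈ Set.extremePoints ℝ D := by
  rw [mem_extremePoints_iff_left]
  refine ⟨phi_mem_D hS, ?_⟩
  rintro x hx y hy ⟨s, t, hs, ht, hst, he⟩
  have hz : ∀ N a, S N ≠ a → x N a = 0 := by
    intro N a hne
    have h := congrFun (congrFun he N) a
    simp only [Pi.add_apply, Pi.smul_apply, smul_eq_mul, phi, if_neg hne] at h
    have h1 := hx.1 N a
    have h2 := mul_nonneg ht.le (hy.1 N a)
    have h3 := mul_nonneg hs.le h1
    have h4 : s * x N a = 0 := by linarith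
    rcases mul_eq_zero.1 h4 with h | h
    · exact absurd h hs.ne'
    · exact h
  funext N a
  by_cases h : S N = a
  · subst h
    have hs := hx.2.2.1 N
    rw [Finset.sum_eq_single (S N) (fun b _ hb => hz N b (Ne.symm hb))
      (fun hb => by
        have := hS.1 N
        simp only [Finset.mem_range] at hb
        omega)] at hs
    simp [phi, hs]
  · simp [phi, h, hz N a h]

theorem measSet (N a : ℕ) : MeasurableSet {S : Path | S N = a} :=
  measurableSet_eq_fun (measurable_pi_apply N) measurable_const

theorem phi_measurable : Measurable phi := by
  refine measurable_pi_lambda _ fun N => measurable_pi_lambda _ fun a => ?_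
  unfold phi
  exact Measurable.ite (measSet N a)
    measurable_const measurable_const

def box : Set (ℕ → ℕ → ℝ) :=
  Set.pi Set.univ fun _ => Set.pi Set.univ fun _ => Set.Icc (0 : ℝ) 1

theorem box_compact : IsCompact box :=
  isCompact_univ_pi fun _ => isCompact_univ_pi fun _ => isCompact_Icc

theorem D_sub_box : D ⊆ box := by
  intro ν hν N _ a _
  refine ⟨hν.1 N a, ?_⟩
  by_cases h : a ≤ N
  · rw [← hν.2.2.1 N]
    exact Finset.single_le_sum (f := fun a => ν N a) (fun i _ => hν.1 N i)
      (Finset.mem_range.2 (by omega))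
  · rw [hν.2.1 N a (by omega)]
    norm_num

theorem D_closed : IsClosed D := by
  have hc : ∀ N a, Continuous fun ν : ℕ → ℕ → ℝ => ν N a := fun N a => by fun_prop
  simp only [D, Set.setOf_and, Set.setOf_forall]
  refine IsClosed.inter ?_ (IsClosed.inter ?_ (IsClosed.inter ?_ ?_))
  · exact isClosed_iInter fun N => isClosed_iInter fun a => isClosed_le continuous_const (hc N a)
  · exact isClosed_iInter fun N => isClosed_iInter fun a => isClosed_iInter fun _ =>
      isClosed_eq (hc N a) continuous_const
  · exact isClosed_iInter fun N =>
      isClosed_eq (continuous_finset_sum _ fun a _ => hc N a) continuous_const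
  · exact isClosed_iInter fun N => isClosed_iInter fun a => isClosed_iInter fun _ =>
      isClosed_le (hc (N + 1) a) (hc N a)

theorem D_compact : IsCompact D := box_compact.of_isClosed_subset D_closed D_sub_box

theorem D_convex : Convex ℝ D := by
  intro x hx y hy s t hs ht hst
  refine ⟨?_, ?_, ?_, ?_⟩
  · intro N a
    exact add_nonneg (mul_nonneg hs (hx.1 N a)) (mul_nonneg ht (hy.1 N a))
  · intro N a h
    simp [hx.2.1 N a h, hy.2.1 N a h]
  · intro N
    simp [Finset.sum_add_distrib, ← Finset.mul_sum, hx.2.2.1 N, hy.2.2.1 N, hst]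
  · intro N a h
    exact add_le_add (mul_le_mul_of_nonneg_left (hx.2.2.2 N a h) hs)
      (mul_le_mul_of_nonneg_left (hy.2.2.2 N a h) ht)

def trunc (n : ℕ) (y : ℕ → ℕ → ℝ) : ℕ → ℕ → ℝ :=
  ∑ N ∈ Finset.range n, ∑ a ∈ Finset.range n, y N a • Pi.single N (Pi.single a (1 : ℝ))

theorem trunc_apply (n : ℕ) (y : ℕ → ℕ → ℝ) (N a : ℕ) :
    trunc n y N a = if N < n ∧ a < n then y N a else 0 := by
  have h : ∀ M b : ℕ, (Pi.single M (Pi.single b (1 : ℝ)) : ℕ → ℕ → ℝ) N a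
      = if N = M then (if a = b then 1 else 0) else 0 := by
    intro M b
    by_cases h : N = M
    · subst h
      simp [Pi.single_apply]
    · simp [Pi.single_apply, h]
  simp only [trunc, Finset.sum_apply, Pi.smul_apply, smul_eq_mul, h]
  by_cases h1 : N < n <;> by_cases h2 : a < n <;> simp [h1, h2]

theorem trunc_tendsto (y : ℕ → ℕ → ℝ) : Tendsto (fun n => trunc n y) atTop (nhds y) := by
  rw [tendsto_pi_nhds]
  intro N
  rw [tendsto_pi_nhds]
  intro a
  refine tendsto_const_nhds.congr' ?_
  filter_upwards [eventually_gt_atTop N, eventually_gt_atTop a] with n h1 h2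
  rw [trunc_apply, if_pos ⟨h1, h2⟩]

theorem trunc_box {y : ℕ → ℕ → ℝ} (hy : y ∈ box) (n : ℕ) : trunc n y ∈ box := by
  intro N _ a _
  rw [trunc_apply]
  split_ifs
  · exact hy N trivial a trivial
  · norm_num

theorem integral_clm (m : Measure (ℕ → ℕ → ℝ)) [IsProbabilityMeasure m]
    (hD : ∀ᵐ y ∂m, y ∈ D) (ν : ℕ → ℕ → ℝ) (hν : ∀ N a, ∫ y, y N a ∂m = ν N a)
    (g : (ℕ → ℕ → ℝ) →L[ℝ] ℝ) : Integrable g m ∧ ∫ y, g y ∂m = g ν := by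
  obtain ⟨C, hC⟩ := box_compact.exists_bound_of_continuousOn g.continuous.continuousOn
  have hgt : ∀ n y, g (trunc n y) = ∑ N ∈ Finset.range n, ∑ a ∈ Finset.range n,
      y N a * g (Pi.single N (Pi.single a (1 : ℝ))) := by
    intro n y
    simp [trunc, map_sum]
  have hmeas : ∀ N a, Measurable fun y : ℕ → ℕ → ℝ => y N a := fun N a => by fun_prop
  have hint : ∀ N a, Integrable (fun y : ℕ → ℕ → ℝ => y N a) m := by
    intro N a
    refine Integrable.of_bound (hmeas N a).aestronglyMeasurable 1 ?_
    filter_upwards [hD] with y hy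
    have := D_sub_box hy N trivial a trivial
    rw [Real.norm_eq_abs, abs_of_nonneg this.1]
    exact this.2
  have hgm : AEStronglyMeasurable g m := g.continuous.aestronglyMeasurable
  refine ⟨Integrable.of_bound hgm C ?_, ?_⟩
  · filter_upwards [hD] with y hy using hC y (D_sub_box hy)
  have h1 : Tendsto (fun n => ∫ y, g (trunc n y) ∂m) atTop (nhds (∫ y, g y ∂m)) := by
    refine tendsto_integral_of_dominated_convergence (fun _ => C) ?_ (integrable_const C) ?_ ?_
    · intro n
      simp only [hgt]
      refine Measurable.aestronglyMeasurable ?_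
      exact Finset.measurable_sum _ fun N _ => Finset.measurable_sum _ fun a _ =>
        (hmeas N a).mul_const _
    · intro n
      filter_upwards [hD] with y hy using hC _ (trunc_box (D_sub_box hy) n)
    · exact Eventually.of_forall fun y => (g.continuous.tendsto y).comp (trunc_tendsto y)
  have h2 : ∀ n, ∫ y, g (trunc n y) ∂m = g (trunc n ν) := by
    intro n
    simp only [hgt]
    rw [integral_finset_sum _ fun N _ => integrable_finset_sum _ fun a _ => (hint N a).mul_const _]
    refine Finset.sum_congr rfl fun N _ => ?_
    rw [integral_finset_sum _ fun a _ => (hint N a).mul_const _]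
    refine Finset.sum_congr rfl fun a _ => ?_
    rw [integral_mul_const, hν]
  simp only [h2] at h1
  exact tendsto_nhds_unique h1 ((g.continuous.tendsto ν).comp (trunc_tendsto ν))

theorem represents (m : Measure (ℕ → ℕ → ℝ)) [IsProbabilityMeasure m]
    (hD : ∀ᵐ y ∂m, y ∈ D) (ν : ℕ → ℕ → ℝ) (hν : ∀ N a, ∫ y, y N a ∂m = ν N a) :
    RepresentsOn m D ν := by
  intro f hf hfa
  have hfm : AEStronglyMeasurable f m := by
    have := hf.aestronglyMeasurable (μ := m) D_closed.measurableSet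
    rwa [Measure.restrict_eq_self_of_ae_mem hD] at this
  obtain ⟨C, hC⟩ := D_compact.exists_bound_of_continuousOn hf
  have hfi : Integrable f m := by
    refine Integrable.of_bound hfm C ?_
    filter_upwards [hD] with y hy using hC y hy
  let G : Set ((ℕ → ℕ → ℝ) × ℝ) := (fun y => (y, f y)) '' D
  have hGc : IsCompact G := D_compact.image_of_continuousOn (continuousOn_id.prodMk hf)
  have hGv : Convex ℝ G := by
    rintro _ ⟨x, hx, rfl⟩ _ ⟨y, hy, rfl⟩ s t hs ht hst
    refine ⟨s • x + t • y, D_convex hx hy hs ht hst, ?_⟩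
    have h := hfa x hx y hy s hs (by linarith)
    have ht' : t = 1 - s := by linarith
    subst ht'
    simp [h]
  have key : (ν, ∫ y, f y ∂m) ∈ G := by
    by_contra hn
    obtain ⟨g, u, h1, h2⟩ := geometric_hahn_banach_closed_point hGv hGc.isClosed hn
    have hsplit : ∀ y r, g (y, r) = (g.comp (ContinuousLinearMap.inl ℝ _ ℝ)) y + r * g (0, 1) := by
      intro y r
      have : ((y, r) : (ℕ → ℕ → ℝ) × ℝ) = (y, 0) + r • (0, 1) := by simp
      rw [this, map_add, map_smul]
      simp
    obtain ⟨i1, i2⟩ := integral_clm m hD ν hν (g.comp (ContinuousLinearMap.inl ℝ _ ℝ))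
    rw [hsplit, ← i2, ← integral_mul_const, ← integral_add i1 (hfi.mul_const _)] at h2
    have h3 : ∫ y, ((g.comp (ContinuousLinearMap.inl ℝ _ ℝ)) y + f y * g (0, 1)) ∂m
        ≤ ∫ _, u ∂m := by
      refine integral_mono_ae (i1.add (hfi.mul_const _)) (integrable_const u) ?_
      filter_upwards [hD] with y hy
      have := h1 (y, f y) ⟨y, hy, rfl⟩
      rw [hsplit] at this
      exact this.le
    simp only [integral_const, probReal_univ, one_smul] at h3
    linarith
  obtain ⟨y, _, hy⟩ := key
  have e1 := congrArg Prod.fst hy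
  have e2 := congrArg Prod.snd hy
  simp only at e1 e2
  rw [← e1, e2]

/-- `φ(S) := Φ(δ_S)` lands in the extreme points of `𝒟`, and for every `ν ∈ 𝒟`
the pushforward of `Φ⁻¹(ν)` under `φ` is a probability measure giving full mass to `ext 𝒟`
which represents `ν`. -/
theorem statement1 :
    (∀ S ∈ staircaseSet, phi S ∈ Set.extremePoints ℝ D) ∧
    ∀ ν ∈ D, ∀ μ : Measure Path, IsSMC μ → marginals μ = ν →
      IsProbabilityMeasure (μ.map phi) ∧
      (μ.map phi) (Set.extremePoints ℝ D) = 1 ∧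
      RepresentsOn (μ.map phi) D ν := by
  refine ⟨fun S hS => phi_extreme hS, ?_⟩
  intro ν _ μ hμ hm
  obtain ⟨hp, hs, _⟩ := hμ
  have hpm : IsProbabilityMeasure (μ.map phi) :=
    Measure.isProbabilityMeasure_map phi_measurable.aemeasurable
  have hext : (μ.map phi) (Set.extremePoints ℝ D) = 1 := by
    refine le_antisymm prob_le_one ?_
    calc (1 : ℝ≥0∞) = μ staircaseSet := hs.symm
      _ ≤ μ (phi ⁻¹' Set.extremePoints ℝ D) := measure_mono fun S hS => phi_extreme hS
      _ ≤ _ := Measure.le_map_apply phi_measurable.aemeasurable _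
  refine ⟨hpm, hext, ?_⟩
  refine represents _ ?_ ν ?_
  · have h1 : (μ.map phi) D = 1 :=
      le_antisymm prob_le_one (hext ▸ measure_mono extremePoints_subset)
    exact (mem_ae_iff_prob_eq_one D_closed.measurableSet).2 h1
  · intro N a
    have hmeas : Measurable fun y : ℕ → ℕ → ℝ => y N a := by fun_prop
    rw [integral_map phi_measurable.aemeasurable hmeas.aestronglyMeasurable, ← hm]
    have hset : MeasurableSet {S : Path | S N = a} :=
      measSet N a
    have : (fun S : Path => phi S N a) = Set.indicator {S : Path | S N = a} (fun _ => (1 : ℝ)) := by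
      funext S
      simp [phi, Set.indicator_apply]
    rw [this, integral_indicator_const _ hset]
    simp [marginals, pr, Measure.real]

end VMCPaper
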